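/- Last-step decomposition of closed walks: let λ ≥ 0 and z ≥ 0 be constants. Then the following identity holds in [0,∞]: Σ_{walks ω from 0 to 0 with |ω| ≥ 1} w_{λ,z}(ω) = z·λ·Σ_{u ∈ ℤ^d, ‖u‖_1 = 1} G_{λ,z}(0,u). (Equivalently, exp(μ_{λ,z}({0})) − 1 equals the right-hand side.) -/

import Mathlib

open scoped ENNReal NNReal BigOperators Classical

noncomputable section

namespace LWW

/-- A point of the lattice ℤ^d. -/
abbrev Pt (d : ℕ) := Fin d → ℤ

/-- ℓ¹ distance on ℤ^d. -/
def dist1 {d : ℕ} (x y : Pt d) : ℕ := ∑ i, (x i - y i).natAbs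

/-- Nearest-neighbour adjacency on ℤ^d. -/
def Adj {d : ℕ} (x y : Pt d) : Prop := dist1 x y = 1

/-- Auxiliary function for single loop erasure: scan the list, keeping the
self-avoiding prefix `pre`; when the first repeated vertex is met, return the
loop-erased list together with the removed loop. -/
def le1Aux {α : Type*} [DecidableEq α] : List α → List α → List α × Option (List α)
  | pre, [] => (pre, none)
  | pre, x :: rest =>
    if x ∈ pre then
      (pre.takeWhile (fun y => y ≠ x) ++ x :: rest,
        some (pre.dropWhile (fun y => y ≠ x) ++ [x]))
    else le1Aux (pre ++ [x]) rest

/-- Single loop erasure LE¹. -/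
def LE1 {α : Type*} [DecidableEq α] (l : List α) : List α := (le1Aux [] l).1

/-- The loop removed by a single loop erasure (if the list is not self-avoiding). -/
def removedLoop {α : Type*} [DecidableEq α] (l : List α) : Option (List α) := (le1Aux [] l).2

/-- Iterate single loop erasure (with fuel), collecting the multiset of removed loops. -/
def leAux {α : Type*} [DecidableEq α] : ℕ → List α → List α × Multiset (List α)
  | 0, l => (l, 0)
  | n + 1, l =>
    match le1Aux ([] : List α) l with
    | (_, none) => (l, 0)
    | (l', some c) => ((leAux n l').1, c ::ₘ (leAux n l').2)

/-- Loop erasure LE. -/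
def LE {α : Type*} [DecidableEq α] (l : List α) : List α := (leAux l.length l).1

/-- The multiset of loops removed by loop erasure. -/
def erasedLoops {α : Type*} [DecidableEq α] (l : List α) : Multiset (List α) :=
  (leAux l.length l).2

/-- The number of loops removed by loop erasure. -/
def nLoops {α : Type*} [DecidableEq α] (l : List α) : ℕ := Multiset.card (erasedLoops l)

/-- A (finite) nearest-neighbour walk on ℤ^d, recorded as its (nonempty) list of vertices. -/
structure Walk (d : ℕ) where
  pts : List (Pt d)
  ne : pts ≠ []
  chain : pts.Chain' Adj

namespace Walk

variable {d : ℕ}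

/-- The number of steps of a walk. -/
def len (ω : Walk d) : ℕ := ω.pts.length - 1

/-- The initial vertex of a walk. -/
def start (ω : Walk d) : Pt d := ω.pts.headI

/-- The final vertex of a walk. -/
def finish (ω : Walk d) : Pt d := ω.pts.getLastD default

/-- The range (set of visited vertices) of a walk. -/
def range (ω : Walk d) : Set (Pt d) := {x | x ∈ ω.pts}

/-- The `i`-th vertex of a walk. -/
def nth (ω : Walk d) (i : ℕ) : Pt d := ω.pts.getD i default

/-- A walk is a loop if it has at least one step and ends where it began. -/
def IsLoop (ω : Walk d) : Prop := 1 ≤ ω.len ∧ ω.finish = ω.start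

end Walk

/-- The list of vertices of a self-avoiding polygon: a closed nearest-neighbour
walk all of whose vertices are distinct except that the last equals the first. -/
def IsSAPList {d : ℕ} (l : List (Pt d)) : Prop :=
  l.Chain' Adj ∧ 3 ≤ l.length ∧ l.getLastD default = l.headI ∧ l.dropLast.Nodup

/-- Change the initial vertex of a polygon list by a cyclic rotation. -/
def polyRot {d : ℕ} (l : List (Pt d)) (r : ℕ) : List (Pt d) :=
  l.dropLast.rotate r ++ [(l.dropLast.rotate r).headI]

/-- An isometry of the lattice ℤ^d: a bijection preserving ℓ¹ distance. -/
def IsLatticeIso {d : ℕ} (R : Pt d ≃ Pt d) : Prop :=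
  ∀ x y : Pt d, dist1 (R x) (R y) = dist1 x y

/-- The symmetry assumption on the loop activities: invariance under isometries of ℤ^d
and under change of initial vertex and of orientation of the polygon. -/
def SymmAssumption {d : ℕ} (lam : List (Pt d) → ℝ≥0) : Prop :=
  (∀ R : Pt d ≃ Pt d, IsLatticeIso R → ∀ l : List (Pt d), IsSAPList l →
      lam (l.map R) = lam l) ∧
  (∀ l : List (Pt d), IsSAPList l → ∀ r : ℕ, lam (polyRot l r) = lam l) ∧
  (∀ l : List (Pt d), IsSAPList l → lam l.reverse = lam l)

/-- The boundedness assumption: sup over self-avoiding polygons of the activity is finite. -/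
def BoundedAssumption {d : ℕ} (lam : List (Pt d) → ℝ≥0) : Prop :=
  ∃ M : ℝ≥0, ∀ l : List (Pt d), IsSAPList l → lam l ≤ M

/-- The product of the loop activities over the loops erased from `ω`, i.e. λ^{n_L(ω)}. -/
def wt0 {d : ℕ} (lam : List (Pt d) → ℝ≥0) (ω : Walk d) : ℝ≥0∞ :=
  ((erasedLoops ω.pts).map (fun η => (lam η : ℝ≥0∞))).prod

/-- The λ-LWW weight w_{λ,z}(ω) = z^{|ω|} λ^{n_L(ω)}. -/
def wt {d : ℕ} (lam : List (Pt d) → ℝ≥0) (z : ℝ≥0) (ω : Walk d) : ℝ≥0∞ :=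
  (z : ℝ≥0∞) ^ ω.len * wt0 lam ω

/-- The λ-LWW two-point function. -/
def G {d : ℕ} (lam : List (Pt d) → ℝ≥0) (z : ℝ≥0) (x y : Pt d) : ℝ≥0∞ :=
  ∑' ω : Walk d, if ω.start = x ∧ ω.finish = y then wt lam z ω else 0

/-- The λ-LWW loop measure μ_{λ,z}(A;B). -/
def mu {d : ℕ} (lam : List (Pt d) → ℝ≥0) (z : ℝ≥0) (A B : Set (Pt d)) : ℝ≥0∞ :=
  ∑' ω : Walk d,
    if ω.IsLoop ∧ (ω.range ∩ A).Nonempty ∧ ω.range ∩ B = ∅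
    then wt lam z ω / (ω.len : ℝ≥0∞) else 0

/-- The generalized λ-LWW loop measure μ_{λ,z}(A,B;C) with two hitting sets. -/
def mu2 {d : ℕ} (lam : List (Pt d) → ℝ≥0) (z : ℝ≥0) (A B C : Set (Pt d)) : ℝ≥0∞ :=
  ∑' ω : Walk d,
    if ω.IsLoop ∧ (ω.range ∩ A).Nonempty ∧ (ω.range ∩ B).Nonempty ∧ ω.range ∩ C = ∅
    then wt lam z ω / (ω.len : ℝ≥0∞) else 0

/-- exp : [0,∞] → [0,∞] with exp(∞) = ∞. -/
def eexp (x : ℝ≥0∞) : ℝ≥0∞ := if x = ⊤ then ⊤ else ENNReal.ofReal (Real.exp x.toReal)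

/-- The loop-erased λ-LWW weight w̄_{λ,z}(η) of a self-avoiding walk η. -/
def wbar {d : ℕ} (lam : List (Pt d) → ℝ≥0) (z : ℝ≥0) (η : Walk d) : ℝ≥0∞ :=
  ∑' ω : Walk d, if LE ω.pts = η.pts then wt lam z ω else 0

/-- c_n^λ : the total λ-LWW mass of n-step walks started at the origin. -/
def cN {d : ℕ} (lam : List (Pt d) → ℝ≥0) (n : ℕ) : ℝ≥0∞ :=
  ∑' ω : Walk d, if ω.start = 0 ∧ ω.len = n then wt0 lam ω else 0

/-- The susceptibility χ_λ(z) = Σ_n c_n^λ z^n. -/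
def chi {d : ℕ} (lam : List (Pt d) → ℝ≥0) (z : ℝ) : ℝ≥0∞ :=
  ∑' n : ℕ, cN lam n * ENNReal.ofReal z ^ n

/-- The critical point z_c(λ): the radius of convergence of the susceptibility
(for a power series with nonnegative coefficients this is the supremum of the
set of nonnegative z at which the series converges). -/
def zc {d : ℕ} (lam : List (Pt d) → ℝ≥0) : ℝ :=
  sSup {z : ℝ | 0 ≤ z ∧ chi lam z < ⊤}

section Stack

variable {α : Type*} [DecidableEq α]

/-- Add a vertex to the stack of a chronological loop erasure; the head of the stack is the
current position. -/
def push (y : α) (s : List α) : List α :=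
  if y ∈ s then s.dropWhile (fun z => z ≠ y) else y :: s

/-- The reversed loop erasure of a walk listed from its last vertex to its first. -/
def stack : List α → List α
  | [] => []
  | y :: w => push y (stack w)

/-- The number of loops erased from a walk listed from its last vertex to its first. -/
def loopCount : List α → ℕ
  | [] => 0
  | y :: w => loopCount w + if y ∈ stack w then 1 else 0

theorem dropWhile_ne_append_cons {a b : List α} {y : α} (h : y ∉ a) :
    (a ++ y :: b).dropWhile (fun z => z ≠ y) = y :: b := by
  induction a with
  | nil => simp
  | cons c a ih =>
    simp only [List.mem_cons, not_or] at h
    have : c ≠ y := fun e => h.1 e.symm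
    simp only [List.cons_append, List.dropWhile_cons]
    simp [this]
    simpa using ih h.2

theorem takeWhile_ne_append_cons {a b : List α} {y : α} (h : y ∉ a) :
    (a ++ y :: b).takeWhile (fun z => z ≠ y) = a := by
  induction a with
  | nil => simp
  | cons c a ih =>
    simp only [List.mem_cons, not_or] at h
    have : c ≠ y := fun e => h.1 e.symm
    simp only [List.cons_append, List.takeWhile_cons]
    simp [this]
    simpa using ih h.2

theorem push_of_not_mem {y : α} {s : List α} (h : y ∉ s) : push y s = y :: s := if_neg h

theorem push_append_cons {a b : List α} {y : α} (h : y ∉ a) : push y (a ++ y :: b) = y :: b := by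
  rw [push, if_pos (by simp), dropWhile_ne_append_cons h]

theorem push_eq (y : α) (s : List α) :
    (y ∉ s ∧ push y s = y :: s) ∨
      ∃ a b, s = a ++ y :: b ∧ y ∉ a ∧ push y s = y :: b := by
  by_cases h : y ∈ s
  · right
    obtain ⟨a, b, hs, ha⟩ := List.eq_append_cons_of_mem h
    exact ⟨a, b, hs, ha, by rw [hs, push_append_cons ha]⟩
  · exact Or.inl ⟨h, push_of_not_mem h⟩

theorem push_nodup {y : α} {s : List α} (h : s.Nodup) : (push y s).Nodup := by
  rcases push_eq y s with ⟨hy, e⟩ | ⟨a, b, rfl, -, e⟩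
  · rw [e]; exact List.nodup_cons.2 ⟨hy, h⟩
  · rw [e]; exact h.sublist (List.sublist_append_right _ _)

theorem stack_nodup (w : List α) : (stack w).Nodup := by
  induction w with
  | nil => simp [stack]
  | cons y w ih => exact push_nodup ih

theorem stack_sublist (w : List α) : (stack w).Sublist w := by
  induction w with
  | nil => simp [stack]
  | cons y w ih =>
    rw [stack]
    rcases push_eq y (stack w) with ⟨-, e⟩ | ⟨a, b, hs, -, e⟩
    · rw [e]; exact ih.cons_cons y
    · rw [e]
      refine ((List.sublist_append_right a _).trans ?_).trans (List.sublist_cons_self y w)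
      rw [← hs]; exact ih

theorem stack_head? (w : List α) : (stack w).head? = w.head? := by
  cases w with
  | nil => simp [stack]
  | cons y w =>
    rw [stack]
    rcases push_eq y (stack w) with ⟨-, e⟩ | ⟨a, b, hs, -, e⟩ <;> simp [e]

theorem stack_getLast? (w : List α) : (stack w).getLast? = w.getLast? := by
  induction w with
  | nil => simp [stack]
  | cons y w ih =>
    rw [stack]
    have key : (push y (stack w)).getLast? = (y :: stack w).getLast? := by
      rcases push_eq y (stack w) with ⟨-, e⟩ | ⟨a, b, hs, -, e⟩
      · rw [e]
      · rw [e, hs]; simp [List.getLast?_cons]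
    rw [key, List.getLast?_cons, List.getLast?_cons, ih]

theorem stack_isChain {R : α → α → Prop} {w : List α} (h : w.IsChain R) :
    (stack w).IsChain R := by
  induction w with
  | nil => simp [stack]
  | cons y w ih =>
    have h' := List.isChain_cons.1 h
    rw [stack]
    rcases push_eq y (stack w) with ⟨-, e⟩ | ⟨a, b, hs, -, e⟩
    · rw [e]; exact List.isChain_cons.2 ⟨by rw [stack_head?]; exact h'.1, ih h'.2⟩
    · rw [e]
      have := ih h'.2
      rw [hs] at this
      exact this.right_of_append

theorem push_eq_cons_iff {y : α} {s r : List α} (hs : s.Nodup) (hr : y ∉ r) :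
    push y s = y :: r ↔ s = r ∨ ∃ t, s = t ++ y :: r := by
  constructor
  · intro h
    rcases push_eq y s with ⟨hy, e⟩ | ⟨a, b, e', ha, e⟩
    · left; rw [e] at h; simpa using h
    · right; rw [e] at h
      obtain rfl : b = r := by simpa using h
      exact ⟨a, e'⟩
  · rintro (rfl | ⟨t, rfl⟩)
    · exact push_of_not_mem hr
    · refine push_append_cons fun hy => ?_
      exact (List.nodup_append.1 hs).2.2 y hy y (by simp) rfl

theorem le1Aux_append {p q rest : List α} (h : (p ++ q).Nodup) :
    le1Aux p (q ++ rest) = le1Aux (p ++ q) rest := by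
  induction q generalizing p with
  | nil => simp
  | cons x q ih =>
    have hx : x ∉ p := fun hx => (List.nodup_append.1 h).2.2 x hx x (by simp) rfl
    rw [List.cons_append, le1Aux, if_neg hx, ih (by simpa using h)]
    simp

theorem card_leAux (rest : List α) : ∀ (n : ℕ) (w : List α), rest.length ≤ n →
    Multiset.card (leAux n ((stack w).reverse ++ rest)).2 + loopCount w
      = loopCount (rest.reverse ++ w) := by
  induction rest with
  | nil =>
    intro n w _
    have h : ([] ++ (stack w).reverse).Nodup := by simpa using stack_nodup w
    have := le1Aux_append (rest := []) h
    cases n with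
    | zero => simp [leAux]
    | succ n => rw [leAux, this]; simp [le1Aux]
  | cons x rest ih =>
    intro n w hn
    rw [List.reverse_cons, List.append_assoc, List.singleton_append]
    rcases push_eq x (stack w) with ⟨hx, e⟩ | ⟨a, b, hs, ha, e⟩
    · have := ih n (x :: w) (by simp at hn; omega)
      rw [← this, stack, e, loopCount, if_neg hx]
      simp
    · have hx : x ∈ stack w := by rw [hs]; simp
      obtain ⟨m, rfl⟩ : ∃ m, n = m + 1 := ⟨n - 1, by simp at hn; omega⟩
      have h : ([] ++ (stack w).reverse).Nodup := by simpa using stack_nodup w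
      have h1 := le1Aux_append (rest := x :: rest) h
      have hxb : x ∉ b.reverse := by
        have := stack_nodup w
        rw [hs] at this
        have := (List.nodup_append.1 this).2.1
        simpa using (List.nodup_cons.1 this).1
      have h2 : (stack w).reverse.takeWhile (fun y => y ≠ x) = b.reverse := by
        rw [hs, List.reverse_append, List.reverse_cons, List.append_assoc,
          List.singleton_append, takeWhile_ne_append_cons hxb]
      have := ih m (x :: w) (by simp at hn; omega)
      rw [← this, leAux, h1, List.nil_append, le1Aux, if_pos (by simpa using hx), h2]
      simp only [Multiset.card_cons, stack, loopCount, e, if_pos hx, List.reverse_cons,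
        List.append_assoc, List.singleton_append]
      omega

theorem card_erasedLoops (l : List α) :
    Multiset.card (erasedLoops l) = loopCount l.reverse := by
  simpa [stack, loopCount, erasedLoops] using card_leAux l l.length [] le_rfl

end Stack

section Partition

variable {α : Type*} [DecidableEq α] {A : Type*} [CommRing A]

/-- The sum over set partitions of `V` of the product of the weights `f` of the blocks, computed
by repeatedly splitting off the block of a chosen point. -/
def partitionSum (f : Finset α → A) (V : Finset α) : A :=
  if h : V.Nonempty then
    ∑ S ∈ (V.powerset.filter (h.choose ∈ ·)).attach, f S.1 * partitionSum f (V \ S.1)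
  else 1
termination_by V.card
decreasing_by
  have hS := Finset.mem_filter.1 S.2
  exact Finset.card_lt_card
    (Finset.sdiff_ssubset (Finset.mem_powerset.1 hS.1) ⟨_, hS.2⟩)

theorem partitionSum_empty (f : Finset α → A) : partitionSum f ∅ = 1 := by
  rw [partitionSum]; simp

theorem partitionSum_choose (f : Finset α → A) {V : Finset α} (h : V.Nonempty) :
    partitionSum f V =
      ∑ S ∈ V.powerset with h.choose ∈ S, f S * partitionSum f (V \ S) := by
  conv_lhs => rw [partitionSum]
  rw [dif_pos h]
  exact Finset.sum_attach (V.powerset.filter (h.choose ∈ ·))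
    (fun S => f S * partitionSum f (V \ S))

/-- Splitting off the blocks of two points, the part where these blocks differ. -/
theorem sum_two_blocks (F : Finset α → Finset α → A) {V : Finset α} {x y : α} :
    (∑ S ∈ V.powerset with x ∈ S ∧ y ∉ S, ∑ T ∈ (V \ S).powerset with y ∈ T, F S T) =
      ∑ T ∈ V.powerset with y ∈ T ∧ x ∉ T, ∑ S ∈ (V \ T).powerset with x ∈ S, F S T := by
  apply Finset.sum_comm'
  intro S T
  simp only [Finset.mem_filter, Finset.mem_powerset, Finset.subset_sdiff]
  constructor
  · rintro ⟨⟨hS, hx, hy⟩, ⟨hT, hd⟩, hyT⟩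
    exact ⟨⟨⟨hS, hd.symm⟩, hx⟩, hT, hyT, fun h => Finset.disjoint_left.1 hd h hx⟩
  · rintro ⟨⟨⟨hS, hd⟩, hx⟩, hT, hyT, hxT⟩
    exact ⟨⟨hS, hx, fun h => Finset.disjoint_left.1 hd h hyT⟩, ⟨hT, hd.symm⟩, hyT⟩

theorem partitionSum_eq (f : Finset α → A) (V : Finset α) :
    ∀ x ∈ V, partitionSum f V = ∑ S ∈ V.powerset with x ∈ S, f S * partitionSum f (V \ S) := by
  induction V using Finset.strongInduction with
  | H V ih =>
    have key : ∀ x ∈ V, ∀ y ∈ V,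
        (∑ S ∈ V.powerset with x ∈ S, f S * partitionSum f (V \ S)) =
          (∑ S ∈ V.powerset with x ∈ S ∧ y ∈ S, f S * partitionSum f (V \ S)) +
          ∑ S ∈ V.powerset with x ∈ S ∧ y ∉ S, ∑ T ∈ (V \ S).powerset with y ∈ T,
            f S * f T * partitionSum f (V \ (S ∪ T)) := by
      intro x hx y hy
      rw [← Finset.sum_filter_add_sum_filter_not _ (y ∈ ·), Finset.filter_filter,
        Finset.filter_filter]
      congr 1
      refine Finset.sum_congr rfl fun S hS => ?_
      simp only [Finset.mem_filter, Finset.mem_powerset] at hS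
      rw [ih (V \ S) (Finset.sdiff_ssubset hS.1 ⟨x, hS.2.1⟩) y
        (Finset.mem_sdiff.2 ⟨hy, hS.2.2⟩), Finset.mul_sum]
      refine Finset.sum_congr rfl fun T _ => ?_
      rw [sdiff_sdiff_left, mul_assoc]
      rfl
    intro x hx
    have hV : V.Nonempty := ⟨x, hx⟩
    have hy := hV.choose_spec
    rw [partitionSum_choose f hV]
    generalize hV.choose = y at hy
    rw [key x hx y hy, key y hy x hx, sum_two_blocks]
    congr 1
    · simp only [and_comm]
    · refine Finset.sum_congr rfl fun S _ => Finset.sum_congr rfl fun T _ => ?_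
      rw [Finset.union_comm, mul_comm (f S)]

variable {f g : Finset α → A}

/-- Splitting off the singleton block of `x`. -/
theorem partitionSum_sub_erase (hf : ∀ S, f S = g S + if S.card = 1 then 1 else 0)
    {V : Finset α} {x : α} (hx : x ∈ V) :
    partitionSum f V - partitionSum f (V.erase x) =
      ∑ S ∈ V.powerset with x ∈ S, g S * partitionSum f (V \ S) := by
  rw [partitionSum_eq f V x hx, sub_eq_iff_eq_add]
  simp only [hf, add_mul, Finset.sum_add_distrib]
  congr 1
  rw [Finset.sum_eq_single {x}]
  · simp [Finset.sdiff_singleton_eq_erase]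
  · intro S hS hne
    simp only [Finset.mem_filter, Finset.mem_powerset] at hS
    have : S.card ≠ 1 := fun h => by
      obtain ⟨a, rfl⟩ := Finset.card_eq_one.1 h
      simp only [Finset.mem_singleton] at hS
      exact hne (by rw [hS.2])
    simp [this]
  · intro h
    simp [hx] at h

/-- If the weight of a block of `k ≥ 2` points is homogeneous of degree `k` with respect to a
derivation, the derivative of the sum over partitions is the sum over all points of the part where
the point is not a singleton. -/
theorem derivation_partitionSum {K : Type*} [CommRing K] [Algebra K A] (D : Derivation K A A)
    (hf : ∀ S, f S = g S + if S.card = 1 then 1 else 0)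
    (hD : ∀ S, D (g S) = (S.card : A) * g S) (V : Finset α) :
    D (partitionSum f V) = ∑ x ∈ V, (partitionSum f V - partitionSum f (V.erase x)) := by
  have hDf : ∀ S, D (f S) = (S.card : A) * g S := by
    intro S
    rw [hf, map_add, hD]
    split_ifs <;> simp
  induction V using Finset.strongInduction with
  | H V ih =>
    rcases V.eq_empty_or_nonempty with rfl | ⟨x, hx⟩
    · simp [partitionSum_empty]
    have hlhs : D (partitionSum f V) = ∑ S ∈ V.powerset with x ∈ S,
        ((S.card : A) * g S * partitionSum f (V \ S) +
          f S * ∑ y ∈ V \ S, (partitionSum f (V \ S) - partitionSum f ((V \ S).erase y))) := by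
      rw [partitionSum_eq f V x hx, map_sum]
      refine Finset.sum_congr rfl fun S hS => ?_
      simp only [Finset.mem_filter, Finset.mem_powerset] at hS
      rw [Derivation.leibniz, hDf, ih _ (Finset.sdiff_ssubset hS.1 ⟨x, hS.2⟩)]
      simp only [smul_eq_mul]
      ring
    have herase : ∀ y ∈ V.erase x, partitionSum f V - partitionSum f (V.erase y) =
        ∑ S ∈ V.powerset with x ∈ S, f S *
          (partitionSum f (V \ S) - if y ∈ S then 0 else partitionSum f ((V \ S).erase y)) := by
      intro y hy
      rw [Finset.mem_erase] at hy
      simp only [mul_sub, Finset.sum_sub_distrib]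
      rw [partitionSum_eq f V x hx,
        partitionSum_eq f (V.erase y) x (Finset.mem_erase.2 ⟨hy.1.symm, hx⟩)]
      congr 1
      simp only [mul_ite, mul_zero]
      rw [Finset.sum_ite, Finset.sum_const_zero, zero_add, Finset.filter_filter]
      refine Finset.sum_congr ?_ fun S hS => ?_
      · ext S
        simp only [Finset.mem_filter, Finset.mem_powerset, Finset.subset_erase]
        tauto
      · rw [Finset.erase_sdiff_comm]
    rw [hlhs, ← Finset.add_sum_erase V _ hx, Finset.sum_congr rfl herase,
      partitionSum_sub_erase hf hx, Finset.sum_comm, ← Finset.sum_add_distrib]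
    refine Finset.sum_congr rfl fun S hS => ?_
    simp only [Finset.mem_filter, Finset.mem_powerset] at hS
    have hsplit : ∑ y ∈ V.erase x,
        (partitionSum f (V \ S) - if y ∈ S then 0 else partitionSum f ((V \ S).erase y)) =
        ((S.card : A) - 1) * partitionSum f (V \ S) +
          ∑ y ∈ V \ S, (partitionSum f (V \ S) - partitionSum f ((V \ S).erase y)) := by
      have hV : V.erase x = S.erase x ∪ V \ S := by
        ext y
        simp only [Finset.mem_erase, Finset.mem_union, Finset.mem_sdiff]
        constructor
        · rintro ⟨h1, h2⟩
          by_cases h : y ∈ S <;> simp [h, h1, h2]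
        · rintro (⟨h1, h2⟩ | ⟨h1, h2⟩)
          · exact ⟨h1, hS.1 h2⟩
          · exact ⟨fun h => h2 (h ▸ hS.2), h1⟩
      have hdisj : Disjoint (S.erase x) (V \ S) :=
        Finset.disjoint_sdiff.mono_left (Finset.erase_subset _ _)
      rw [hV, Finset.sum_union hdisj]
      congr 1
      · have hcard : ((S.erase x).card : A) = (S.card : A) - 1 := by
          rw [Finset.card_erase_of_mem hS.2, Nat.cast_pred (Finset.card_pos.2 ⟨x, hS.2⟩)]
        rw [← hcard, ← nsmul_eq_mul, ← Finset.sum_const]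
        refine Finset.sum_congr rfl fun y hy => ?_
        rw [if_pos (Finset.mem_of_mem_erase hy), sub_zero]
      · refine Finset.sum_congr rfl fun y hy => ?_
        rw [if_neg (Finset.mem_sdiff.1 hy).2]
    rw [← Finset.mul_sum, hsplit]
    have hc : (S.card : A) * g S = g S + ((S.card : A) - 1) * f S := by
      rw [hf]
      split_ifs with h
      · rw [h]; ring
      · ring
    rw [hc]
    ring

end Partition

section Cycles

open PowerSeries

theorem isRotated_cons_inj {α : Type*} {y : α} {t u : List α} (hn : (y :: t).Nodup)
    (h : (y :: t) ~r (y :: u)) : t = u := by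
  obtain ⟨n, hn'⟩ := h
  have hlen : 0 < (y :: t).length := by simp
  have hmod : n % (y :: t).length < (y :: t).length := Nat.mod_lt _ hlen
  have h0 : ((y :: t).rotate n)[0]? = some y := by rw [hn']; rfl
  rw [List.getElem?_rotate hlen, zero_add] at h0
  have h1 : (y :: t)[0]? = some y := rfl
  have : n % (y :: t).length = 0 := by
    exact (List.getElem?_inj hmod hn).1 (h0.trans h1.symm)
  rw [← List.rotate_mod, this, List.rotate_zero] at hn'
  simpa using hn'

variable {α : Type*} [DecidableEq α] (R : α → α → Prop)

/-- The number of simple directed cycles of the relation `R` with vertex set `S`. -/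
def cycleCount (S : Finset α) : ℕ :=
  Set.ncard {c : Cycle α | c.Nodup ∧ c.toFinset = S ∧ c.Chain R}

/-- The simple directed cycles through `y` inside `V`, with the initial vertex `y` removed. -/
def cyclesAt (y : α) (V : Finset α) : Finset (List α) :=
  (V.powerset.biUnion fun S => S.val.lists.toFinset).filter fun t =>
    (y :: t).Nodup ∧ y ∈ V ∧ Cycle.Chain R (y :: t : List α)

variable {R}

theorem mem_cyclesAt {y : α} {V : Finset α} {t : List α} :
    t ∈ cyclesAt R y V ↔
      (y :: t).Nodup ∧ (∀ z ∈ y :: t, z ∈ V) ∧ Cycle.Chain R (y :: t : List α) := by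
  simp only [cyclesAt, Finset.mem_filter, Finset.mem_biUnion, Finset.mem_powerset,
    Multiset.mem_toFinset, Multiset.mem_lists_iff, List.forall_mem_cons]
  constructor
  · rintro ⟨⟨S, hS, hSt⟩, hn, hy, hc⟩
    refine ⟨hn, ⟨hy, fun z hz => hS ?_⟩, hc⟩
    rw [← Finset.mem_val, hSt]
    exact hz
  · rintro ⟨hn, ⟨hy, ht⟩, hc⟩
    refine ⟨⟨t.toFinset, fun z hz => ht z (List.mem_toFinset.1 hz), ?_⟩, hn, hy, hc⟩
    simp [List.toFinset_val, (List.nodup_cons.1 hn).2.dedup]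

theorem card_cyclesAt_toFinset {y : α} {V S : Finset α} (hS : S ⊆ V) (hy : y ∈ S) :
    ((cyclesAt R y V).filter fun t => (y :: t).toFinset = S).card = cycleCount R S := by
  rw [cycleCount, ← Set.ncard_coe_finset,
    ← Set.InjOn.ncard_image (f := fun t => ((y :: t : List α) : Cycle α))]
  · congr 1
    ext c
    simp only [Set.mem_image, Finset.mem_coe, Finset.mem_filter, mem_cyclesAt, Set.mem_ofPred_eq]
    constructor
    · rintro ⟨t, ⟨⟨h1, h2, h3⟩, h4⟩, rfl⟩
      exact ⟨h1, h4, h3⟩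
    · induction c using Quotient.inductionOn' with
      | h l =>
        rintro ⟨h1, h2, h3⟩
        change l.Nodup at h1
        change l.toFinset = S at h2
        have hyl : y ∈ l := by rw [← List.mem_toFinset, h2]; exact hy
        obtain ⟨a, b, rfl⟩ := List.append_of_mem hyl
        have hrot : ((y :: (b ++ a) : List α) : Cycle α) = ((a ++ y :: b : List α) : Cycle α) := by
          rw [Cycle.coe_eq_coe]
          have := List.isRotated_append (l := y :: b) (l' := a)
          simpa using this
        refine ⟨b ++ a, ⟨⟨?_, ?_, ?_⟩, ?_⟩, hrot⟩
        · rw [← Cycle.nodup_coe_iff, hrot]; exact h1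
        · intro z hz
          apply hS
          rw [← h2]
          simp only [List.mem_cons, List.mem_append, List.mem_toFinset] at hz ⊢
          tauto
        · rw [hrot]; exact h3
        · rw [← h2]
          ext z
          simp only [List.mem_cons, List.mem_append, List.mem_toFinset]
          tauto
  · intro t ht u _ h
    simp only [Finset.mem_coe, Finset.mem_filter, mem_cyclesAt] at ht
    exact isRotated_cons_inj ht.1.1 (Cycle.coe_eq_coe.1 h)

variable (R) in
/-- The generating function of the collections of disjoint simple cycles in `V`, each cycle
carrying the weight `-lam`. -/
def cyclePartition (lam : ℝ) (V : Finset α) : ℝ⟦X⟧ :=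
  partitionSum (fun S => -(C lam * X ^ S.card * (cycleCount R S : ℝ⟦X⟧)) +
    if S.card = 1 then 1 else 0) V

theorem cyclePartition_sub_erase (lam : ℝ) {V : Finset α} {y : α} (hy : y ∈ V) :
    cyclePartition R lam V = cyclePartition R lam (V.erase y) -
      C lam * ∑ t ∈ cyclesAt R y V,
        X ^ (y :: t).length * cyclePartition R lam (V \ (y :: t).toFinset) := by
  rw [sub_eq_add_neg, ← sub_eq_iff_eq_add']
  unfold cyclePartition
  rw [partitionSum_sub_erase (fun S => rfl) hy, Finset.mul_sum]
  have hmaps : ∀ t ∈ cyclesAt R y V, (y :: t).toFinset ∈ V.powerset.filter (y ∈ ·) := by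
    intro t ht
    rw [mem_cyclesAt] at ht
    simp only [Finset.mem_filter, Finset.mem_powerset]
    exact ⟨fun z hz => ht.2.1 z (List.mem_toFinset.1 hz), by simp⟩
  rw [← Finset.sum_fiberwise_of_maps_to hmaps, ← Finset.sum_neg_distrib]
  refine Finset.sum_congr rfl fun S hS => ?_
  simp only [Finset.mem_filter, Finset.mem_powerset] at hS
  rw [← card_cyclesAt_toFinset hS.1 hS.2]
  rw [Finset.sum_congr rfl (g := fun _ => C lam * (X ^ S.card * partitionSum (fun S =>
      -(C lam * X ^ S.card * (cycleCount R S : ℝ⟦X⟧)) + if S.card = 1 then 1 else 0) (V \ S)))]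
  · rw [Finset.sum_const, nsmul_eq_mul]
    ring
  · intro t ht
    rw [Finset.mem_filter, mem_cyclesAt] at ht
    rw [ht.2, ← List.toFinset_card_of_nodup ht.1.1, ht.2]

theorem constantCoeff_cyclePartition (lam : ℝ) (V : Finset α) :
    constantCoeff (cyclePartition R lam V) = 1 := by
  induction V using Finset.induction_on with
  | empty => simp [cyclePartition, partitionSum_empty]
  | insert y V hy ih =>
    rw [cyclePartition_sub_erase lam (Finset.mem_insert_self y V), Finset.erase_insert hy]
    simp [ih]

theorem X_mul_derivative_cyclePartition (lam : ℝ) (V : Finset α) :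
    X * d⁄dX ℝ (cyclePartition R lam V) =
      ∑ x ∈ V, (cyclePartition R lam V - cyclePartition R lam (V.erase x)) := by
  have := derivation_partitionSum ((X : ℝ⟦X⟧) • d⁄dX ℝ)
    (f := fun S => -(C lam * X ^ S.card * (cycleCount R S : ℝ⟦X⟧)) +
      if S.card = 1 then 1 else 0) (fun S => rfl) ?_ V
  · simpa [cyclePartition] using this
  · intro S
    simp only [Derivation.smul_apply, smul_eq_mul, map_neg, Derivation.leibniz,
      Derivation.leibniz_pow, Derivation.map_natCast, derivative_C, derivative_X]
    rcases S.card with _ | n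
    · simp
    · simp
      ring

end Cycles

section StackWeights

open PowerSeries

variable {α : Type*} [DecidableEq α] (R : α → α → Prop)

/-- The total weight of the `n`-step walks from `x` in `V` whose reversed loop erasure is `r`.
Walks are listed from their last vertex to their first. -/
def stackWeight (lam : ℝ≥0) (V : Finset α) (x : α) (n : ℕ) (r : List α) : ℝ≥0∞ :=
  ∑' w : List α, if (w.IsChain R ∧ w.getLast? = some x ∧ w.length = n + 1 ∧ ∀ z ∈ w, z ∈ V) ∧
    stack w = r then (lam : ℝ≥0∞) ^ loopCount w else 0

/-- The coefficients of the generating function of the walks with reversed loop erasure `r`. -/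
def stackCoeff (lam : ℝ) (V : Finset α) (n : ℕ) (r : List α) : ℝ :=
  coeff n (X ^ (r.length - 1) * cyclePartition R lam (V \ r.toFinset) *
    (cyclePartition R lam V)⁻¹)

variable {R} {lam : ℝ≥0} {V : Finset α} {x : α}

theorem stackWeight_zero (hx : x ∈ V) (r : List α) :
    stackWeight R lam V x 0 r = if r = [x] then 1 else 0 := by
  rw [stackWeight, tsum_eq_single [x]]
  · have : stack [x] = [x] := by simp [stack, push]
    simp only [this]
    simp [hx, loopCount, stack, eq_comm]
  · intro w hw
    rw [if_neg]
    rintro ⟨⟨-, h1, h2, -⟩, -⟩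
    obtain ⟨a, rfl⟩ := List.length_eq_one_iff.1 (by simpa using h2)
    simp at h1
    exact hw (by rw [h1])

theorem stackWeight_nil (n : ℕ) : stackWeight R lam V x n [] = 0 := by
  rw [stackWeight, ENNReal.tsum_eq_zero]
  intro w
  rw [if_neg]
  rintro ⟨⟨-, -, h2, -⟩, h⟩
  have := stack_head? w
  rw [h] at this
  cases w <;> simp at h2 this

theorem stackWeight_succ {y : α} {r : List α} (hn : (y :: r).Nodup)
    (hc : (y :: r).IsChain R) (hV : ∀ z ∈ y :: r, z ∈ V) (n : ℕ) :
    stackWeight R lam V x (n + 1) (y :: r) = stackWeight R lam V x n r +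
      lam * ∑ t ∈ cyclesAt R y (V \ r.toFinset), stackWeight R lam V x n (t ++ y :: r) := by
  have hyr := (List.nodup_cons.1 hn).1
  rw [stackWeight, ← (List.cons_injective (a := y)).tsum_eq]
  swap
  · intro w hw
    rw [Function.mem_support] at hw
    have hw' := (ite_ne_right_iff.1 hw).1
    have := stack_head? w
    rw [hw'.2] at this
    cases w with
    | nil => simp at this
    | cons z w => exact ⟨w, by simp at this; rw [this]⟩
  unfold stackWeight
  rw [← Summable.tsum_finsetSum (fun _ _ => ENNReal.summable), ← ENNReal.tsum_mul_left,
    ← ENNReal.tsum_add]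
  refine tsum_congr fun w => ?_
  by_cases hw : w.IsChain R ∧ w.getLast? = some x ∧ w.length = n + 1 ∧ ∀ z ∈ w, z ∈ V
  swap
  · rw [if_neg, if_neg (fun h => hw h.1), Finset.sum_eq_zero, mul_zero, zero_add]
    · intro t _
      exact if_neg fun h => hw h.1
    · rintro ⟨⟨h1, h2, h3, h4⟩, -⟩
      refine hw ⟨(List.isChain_cons.1 h1).2, ?_, by simpa using h3,
        fun z hz => h4 z (List.mem_cons_of_mem _ hz)⟩
      cases w with
      | nil => simp at h3
      | cons a w => simpa [List.getLast?_cons] using h2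
  have hwne : w ≠ [] := by
    rintro rfl
    simp at hw
  have hvalid : ((y :: w).IsChain R ∧ (y :: w).getLast? = some x ∧
      (y :: w).length = n + 1 + 1 ∧ ∀ z ∈ y :: w, z ∈ V) ↔ ∀ z ∈ (stack w).head?, R y z := by
    rw [stack_head?, List.isChain_cons]
    constructor
    · exact fun h => h.1.1
    · intro h
      refine ⟨⟨h, hw.1⟩, ?_, by simp [hw.2.2.1], ?_⟩
      · cases w with
        | nil => simp at hwne
        | cons a w => simpa [List.getLast?_cons] using hw.2.1
      · rw [List.forall_mem_cons]
        exact ⟨hV y (by simp), hw.2.2.2⟩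
  simp only [hvalid, stack, push_eq_cons_iff (stack_nodup w) hyr, loopCount]
  have hsV : ∀ z ∈ stack w, z ∈ V := fun z hz => hw.2.2.2 z ((stack_sublist w).mem hz)
  have hsn := stack_nodup w
  have hsc := stack_isChain hw.1
  generalize stack w = s at hsV hsn hsc
  by_cases hs : s = r
  · subst hs
    rw [if_pos ⟨(List.isChain_cons.1 hc).1, Or.inl rfl⟩, if_neg hyr, if_pos ⟨hw, rfl⟩,
      Finset.sum_eq_zero, mul_zero, add_zero, add_zero]
    intro t _
    rw [if_neg]
    rintro ⟨-, h⟩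
    have := congrArg List.length h
    simp at this
    omega
  rw [if_neg (fun h : _ ∧ s = r => hs h.2), zero_add]
  by_cases ht : ∃ t, s = t ++ y :: r
  swap
  · rw [if_neg (fun h => h.2.elim hs ht), Finset.sum_eq_zero, mul_zero]
    intro t _
    exact if_neg fun h => ht ⟨t, h.2⟩
  obtain ⟨t, rfl⟩ := ht
  have hchain : (∀ z ∈ (t ++ y :: r).head?, R y z) ↔ t ∈ cyclesAt R y (V \ r.toFinset) := by
    have h1 : (y :: t).Nodup := by
      have := List.nodup_append.1 hsn
      exact List.nodup_cons.2 ⟨fun h => this.2.2 y h y (by simp) rfl, this.1⟩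
    have h2 : ∀ z ∈ y :: t, z ∈ V \ r.toFinset := by
      intro z hz
      rw [Finset.mem_sdiff, List.mem_toFinset]
      rcases List.mem_cons.1 hz with rfl | hz
      · exact ⟨hsV z (by simp), hyr⟩
      · exact ⟨hsV z (by simp [hz]),
          fun h => (List.nodup_append.1 hsn).2.2 z hz z (by simp [h]) rfl⟩
    have h3 : (t ++ [y]).IsChain R := by
      have : t ++ y :: r = (t ++ [y]) ++ r := by simp
      rw [this] at hsc
      exact hsc.left_of_append
    rw [mem_cyclesAt, Cycle.chain_coe_cons, List.isChain_cons]
    have h4 : (t ++ [y]).head? = (t ++ y :: r).head? := by cases t <;> simp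
    rw [h4]
    exact ⟨fun h => ⟨h1, h2, h, h3⟩, fun h => h.2.2.1⟩
  simp only [hchain]
  by_cases htc : t ∈ cyclesAt R y (V \ r.toFinset)
  · rw [if_pos ⟨htc, Or.inr ⟨t, rfl⟩⟩, if_pos (by simp), Finset.sum_eq_single_of_mem t htc,
      if_pos ⟨hw, rfl⟩, pow_succ']
    intro u _ hu
    rw [if_neg]
    rintro ⟨-, h⟩
    exact hu (List.append_cancel_right h).symm
  · rw [if_neg (fun h => htc h.1), Finset.sum_eq_zero, mul_zero]
    intro u hu
    rw [if_neg]
    rintro ⟨-, h⟩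
    exact htc (by rwa [List.append_cancel_right h])

theorem mul_inv_cyclePartition (lam : ℝ) (V : Finset α) :
    cyclePartition R lam V * (cyclePartition R lam V)⁻¹ = 1 :=
  PowerSeries.mul_inv_cancel _ (by rw [constantCoeff_cyclePartition]; exact one_ne_zero)

theorem stackCoeff_zero (lam : ℝ) (V : Finset α) {r : List α} (hr : r ≠ []) :
    stackCoeff R lam V 0 r = if r.length = 1 then 1 else 0 := by
  have hinv : constantCoeff (cyclePartition R lam V)⁻¹ = 1 := by
    have := congrArg constantCoeff (mul_inv_cyclePartition (R := R) lam V)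
    rwa [map_mul, constantCoeff_cyclePartition, one_mul, map_one] at this
  have : 0 < r.length := List.length_pos_iff.2 hr
  rw [stackCoeff, coeff_zero_eq_constantCoeff_apply]
  simp only [map_mul, map_pow, constantCoeff_X, constantCoeff_cyclePartition, hinv, mul_one]
  split_ifs with h
  · simp [h]
  · exact zero_pow (by omega)

theorem stackCoeff_succ (lam : ℝ) {y : α} {r : List α} (hn : (y :: r).Nodup)
    (hV : ∀ z ∈ y :: r, z ∈ V) (n : ℕ) :
    stackCoeff R lam V (n + 1) (y :: r) = (if r = [] then 0 else stackCoeff R lam V n r) +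
      lam * ∑ t ∈ cyclesAt R y (V \ r.toFinset), stackCoeff R lam V n (t ++ y :: r) := by
  have hy : y ∈ V \ r.toFinset := by
    rw [Finset.mem_sdiff, List.mem_toFinset]
    exact ⟨hV y (by simp), (List.nodup_cons.1 hn).1⟩
  have hset : V \ (y :: r).toFinset = (V \ r.toFinset).erase y := by
    ext z; simp only [Finset.mem_sdiff, List.mem_toFinset, List.mem_cons, Finset.mem_erase]; tauto
  have hset' : ∀ t : List α, V \ (t ++ y :: r).toFinset =
      (V \ r.toFinset) \ (y :: t).toFinset := by
    intro t
    ext z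
    simp only [Finset.mem_sdiff, List.mem_toFinset, List.mem_cons, List.mem_append]
    tauto
  have key := cyclePartition_sub_erase (R := R) lam hy
  rw [eq_sub_iff_add_eq, eq_comm] at key
  have hmain : X ^ ((y :: r).length - 1) * cyclePartition R lam (V \ (y :: r).toFinset) *
      (cyclePartition R lam V)⁻¹ =
      X ^ r.length * cyclePartition R lam (V \ r.toFinset) * (cyclePartition R lam V)⁻¹ +
      C lam * ∑ t ∈ cyclesAt R y (V \ r.toFinset),
        X * (X ^ ((t ++ y :: r).length - 1) *
          cyclePartition R lam (V \ (t ++ y :: r).toFinset) * (cyclePartition R lam V)⁻¹) := by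
    have hsum : ∑ t ∈ cyclesAt R y (V \ r.toFinset),
        X * (X ^ ((t ++ y :: r).length - 1) *
          cyclePartition R lam (V \ (t ++ y :: r).toFinset) * (cyclePartition R lam V)⁻¹) =
        X ^ r.length * (cyclePartition R lam V)⁻¹ * ∑ t ∈ cyclesAt R y (V \ r.toFinset),
          X ^ (y :: t).length *
            cyclePartition R lam ((V \ r.toFinset) \ (y :: t).toFinset) := by
      rw [Finset.mul_sum]
      refine Finset.sum_congr rfl fun t _ => ?_
      have : (t ++ y :: r).length - 1 = r.length + t.length := by simp; omega
      rw [hset', this, List.length_cons]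
      ring
    rw [hsum, hset, key, List.length_cons, Nat.add_sub_cancel]
    ring
  rw [stackCoeff, hmain, map_add, coeff_C_mul, map_sum]
  congr 1
  · split_ifs with h
    · subst h
      simp [mul_inv_cyclePartition, coeff_one]
    · rw [stackCoeff, ← coeff_succ_X_mul n]
      congr 1
      have : r.length = r.length - 1 + 1 := by
        have := List.length_pos_iff.2 h
        omega
      rw [this, pow_succ', Nat.add_sub_cancel]
      ring
  · congr 1
    refine Finset.sum_congr rfl fun t _ => ?_
    rw [coeff_succ_X_mul, stackCoeff]

theorem stackWeight_eq (hx : x ∈ V) (n : ℕ) : ∀ r : List α, r.Nodup → r.IsChain R →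
    (∀ z ∈ r, z ∈ V) → r.getLast? = some x →
    0 ≤ stackCoeff R lam V n r ∧
      stackWeight R lam V x n r = ENNReal.ofReal (stackCoeff R lam V n r) := by
  induction n with
  | zero =>
    intro r hn hc hV hr
    have hne : r ≠ [] := by rintro rfl; simp at hr
    rw [stackWeight_zero hx, stackCoeff_zero _ _ hne]
    have : r = [x] ↔ r.length = 1 := by
      constructor
      · rintro rfl; rfl
      · intro h
        obtain ⟨a, rfl⟩ := List.length_eq_one_iff.1 h
        simp at hr
        rw [hr]
    simp only [this]
    split_ifs <;> simp
  | succ n ih =>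
    intro r hn hc hV hr
    cases r with
    | nil => simp at hr
    | cons y r =>
      rw [stackWeight_succ hn hc hV, stackCoeff_succ _ hn hV]
      have h1 : 0 ≤ (if r = [] then 0 else stackCoeff R lam V n r) ∧ stackWeight R lam V x n r =
          ENNReal.ofReal (if r = [] then 0 else stackCoeff R lam V n r) := by
        split_ifs with h
        · subst h
          simp [stackWeight_nil]
        · refine ih r (List.nodup_cons.1 hn).2 (List.isChain_cons.1 hc).2
            (fun z hz => hV z (List.mem_cons_of_mem _ hz)) ?_
          cases r with
          | nil => simp at h
          | cons a r => simpa [List.getLast?_cons] using hr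
      have h2 : ∀ t ∈ cyclesAt R y (V \ r.toFinset), 0 ≤ stackCoeff R lam V n (t ++ y :: r) ∧
          stackWeight R lam V x n (t ++ y :: r) =
            ENNReal.ofReal (stackCoeff R lam V n (t ++ y :: r)) := by
        intro t ht
        rw [mem_cyclesAt, Cycle.chain_coe_cons] at ht
        obtain ⟨hn', hV', hc'⟩ := ht
        rw [List.nodup_cons] at hn'
        rw [List.forall_mem_cons] at hV'
        refine ih _ ?_ ?_ ?_ ?_
        · rw [List.nodup_append]
          refine ⟨hn'.2, hn, fun a ha b hb hab => ?_⟩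
          subst hab
          rcases List.mem_cons.1 hb with rfl | hb
          · exact hn'.1 ha
          · exact (Finset.mem_sdiff.1 (hV'.2 a ha)).2 (List.mem_toFinset.2 hb)
        · have hc2 := (List.isChain_cons.1 hc').2
          rw [List.isChain_append] at hc2 ⊢
          exact ⟨hc2.1, hc, by simpa using hc2.2.2⟩
        · intro z hz
          rcases List.mem_append.1 hz with hz | hz
          · exact (Finset.mem_sdiff.1 (hV'.2 z hz)).1
          · exact hV z hz
        · rw [List.getLast?_append, hr]; rfl
      have h3 : 0 ≤ ∑ t ∈ cyclesAt R y (V \ r.toFinset), stackCoeff R lam V n (t ++ y :: r) :=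
        Finset.sum_nonneg fun t ht => (h2 t ht).1
      refine ⟨add_nonneg h1.1 (mul_nonneg lam.coe_nonneg h3), ?_⟩
      rw [ENNReal.ofReal_add h1.1 (mul_nonneg lam.coe_nonneg h3), ENNReal.ofReal_mul lam.coe_nonneg,
        ENNReal.ofReal_sum_of_nonneg (fun t ht => (h2 t ht).1), h1.2,
        Finset.sum_congr rfl (fun t ht => (h2 t ht).2), ENNReal.ofReal_coe_nnreal]

end StackWeights

section ClosedWalks

open PowerSeries

variable {α : Type*} [DecidableEq α] (R : α → α → Prop)

/-- The total weight of the `n`-step closed walks at `x` inside the set `V`. -/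
def closedWeight (lam : ℝ≥0) (V : Set α) (x : α) (n : ℕ) : ℝ≥0∞ :=
  ∑' w : List α, if w.IsChain R ∧ w.getLast? = some x ∧ w.length = n + 1 ∧ (∀ z ∈ w, z ∈ V) ∧
    w.head? = some x then (lam : ℝ≥0∞) ^ loopCount w else 0

/-- The total weight of the `n`-step closed walks inside the set `V` that visit `x`. -/
def hittingWeight (lam : ℝ≥0) (V : Set α) (x : α) (n : ℕ) : ℝ≥0∞ :=
  ∑' w : List α, if w.IsChain R ∧ w.head? = w.getLast? ∧ w.length = n + 1 ∧ (∀ z ∈ w, z ∈ V) ∧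
    x ∈ w then (lam : ℝ≥0∞) ^ loopCount w else 0

/-- The generating function of the closed walks at `x` inside `V`. -/
def closedSeries (lam : ℝ) (V : Finset α) (x : α) : ℝ⟦X⟧ :=
  cyclePartition R lam (V.erase x) * (cyclePartition R lam V)⁻¹

variable {R} {lam : ℝ≥0} {V : Finset α} {x : α}

theorem closedWeight_eq (hx : x ∈ V) (n : ℕ) :
    0 ≤ coeff n (closedSeries R lam V x) ∧
      closedWeight R lam V x n = ENNReal.ofReal (coeff n (closedSeries R lam V x)) := by
  have h := stackWeight_eq (R := R) (lam := lam) hx n [x] (by simp) (by simp) (by simpa) (by simp)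
  have hc : stackCoeff R lam V n [x] = coeff n (closedSeries R lam V x) := by
    rw [stackCoeff, closedSeries]
    simp [Finset.sdiff_singleton_eq_erase]
  have hw : closedWeight R lam V x n = stackWeight R lam V x n [x] := by
    refine tsum_congr fun w => ?_
    congr 1
    apply propext
    simp only [Finset.mem_coe]
    constructor
    · rintro ⟨h1, h2, h3, h4, h5⟩
      refine ⟨⟨h1, h2, h3, h4⟩, ?_⟩
      have hn := stack_nodup w
      rw [← stack_head?] at h5
      rw [← stack_getLast?] at h2
      generalize stack w = s at *
      cases s with
      | nil => simp at h5
      | cons a s =>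
        obtain rfl : a = x := by simpa using h5
        cases s with
        | nil => rfl
        | cons b s =>
          rw [List.getLast?_cons_cons] at h2
          exact absurd (List.mem_of_getLast? h2) (List.nodup_cons.1 hn).1
    · rintro ⟨⟨h1, h2, h3, h4⟩, h5⟩
      refine ⟨h1, h2, h3, h4, ?_⟩
      rw [← stack_head?, h5]
      rfl
  rw [hw, ← hc]
  exact h

theorem sum_closedWeight (n : ℕ) :
    ∑ y ∈ V, closedWeight R lam V y n =
      ∑' w : List α, if w.IsChain R ∧ w.head? = w.getLast? ∧ w.length = n + 1 ∧ ∀ z ∈ w, z ∈ V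
        then (lam : ℝ≥0∞) ^ loopCount w else 0 := by
  unfold closedWeight
  rw [← Summable.tsum_finsetSum (fun _ _ => ENNReal.summable)]
  refine tsum_congr fun w => ?_
  split_ifs with h
  · obtain ⟨h1, h2, h3, h4⟩ := h
    cases w with
    | nil => simp at h3
    | cons a w =>
      rw [Finset.sum_eq_single_of_mem a (h4 a (by simp))]
      · rw [if_pos ⟨h1, by rw [← h2]; rfl, h3, h4, rfl⟩]
      · intro y _ hy
        rw [if_neg]
        rintro ⟨-, -, -, -, h⟩
        exact hy (by simpa using h.symm)
  · refine Finset.sum_eq_zero fun y _ => if_neg ?_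
    rintro ⟨h1, h2, h3, h4, h5⟩
    exact h ⟨h1, by rw [h2, h5], h3, h4⟩

theorem sum_closedWeight_eq_add (n : ℕ) :
    ∑ y ∈ V, closedWeight R lam V y n =
      ∑ y ∈ V.erase x, closedWeight R lam (V.erase x : Finset α) y n +
        hittingWeight R lam V x n := by
  rw [sum_closedWeight, sum_closedWeight, hittingWeight, ← ENNReal.tsum_add]
  refine tsum_congr fun w => ?_
  by_cases hw : w.IsChain R ∧ w.head? = w.getLast? ∧ w.length = n + 1 ∧ ∀ z ∈ w, z ∈ V
  · rw [if_pos hw]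
    by_cases hx : x ∈ w
    · rw [if_neg, if_pos ⟨hw.1, hw.2.1, hw.2.2.1, hw.2.2.2, hx⟩, zero_add]
      rintro ⟨-, -, -, h⟩
      exact Finset.notMem_erase x V (h x hx)
    · rw [if_pos, if_neg, add_zero]
      · exact fun h => hx h.2.2.2.2
      · refine ⟨hw.1, hw.2.1, hw.2.2.1, fun z hz => Finset.mem_erase.2 ⟨?_, hw.2.2.2 z hz⟩⟩
        rintro rfl
        exact hx hz
  · rw [if_neg hw, if_neg, if_neg, zero_add]
    · rintro ⟨h1, h2, h3, h4, -⟩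
      exact hw ⟨h1, h2, h3, h4⟩
    · rintro ⟨h1, h2, h3, h4⟩
      exact hw ⟨h1, h2, h3, fun z hz => Finset.mem_of_mem_erase (h4 z hz)⟩

variable (R) in
/-- The generating function of the closed walks inside `V` that visit `x`. -/
def hittingSeries (lam : ℝ) (V : Finset α) (x : α) : ℝ⟦X⟧ :=
  ∑ y ∈ V, closedSeries R lam V y - ∑ y ∈ V.erase x, closedSeries R lam (V.erase x) y

theorem hittingWeight_eq (n : ℕ) :
    0 ≤ coeff n (hittingSeries R lam V x) ∧
      hittingWeight R lam V x n = ENNReal.ofReal (coeff n (hittingSeries R lam V x)) := by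
  have hsum : ∀ W : Finset α, 0 ≤ ∑ y ∈ W, coeff n (closedSeries R lam W y) ∧
      ∑ y ∈ W, closedWeight R lam W y n =
        ENNReal.ofReal (∑ y ∈ W, coeff n (closedSeries R lam W y)) := by
    intro W
    refine ⟨Finset.sum_nonneg fun y hy => (closedWeight_eq hy n).1, ?_⟩
    rw [ENNReal.ofReal_sum_of_nonneg fun y hy => (closedWeight_eq hy n).1]
    exact Finset.sum_congr rfl fun y hy => (closedWeight_eq hy n).2
  have h := sum_closedWeight_eq_add (R := R) (lam := lam) (V := V) (x := x) n
  rw [(hsum V).2, (hsum (V.erase x)).2] at h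
  rw [hittingSeries, map_sub, map_sum, map_sum]
  constructor
  · rw [sub_nonneg, ← ENNReal.ofReal_le_ofReal_iff (hsum V).1, h]
    exact le_self_add
  · rw [ENNReal.ofReal_sub _ (hsum (V.erase x)).1, h,
      ENNReal.add_sub_cancel_left ENNReal.ofReal_ne_top]

theorem X_mul_derivative_eq_mul_closedSeries (lam : ℝ) (V : Finset α) :
    X * d⁄dX ℝ (cyclePartition R lam V) =
      cyclePartition R lam V * ((V.card : ℝ⟦X⟧) - ∑ y ∈ V, closedSeries R lam V y) := by
  rw [X_mul_derivative_cyclePartition, Finset.sum_sub_distrib, Finset.sum_const, nsmul_eq_mul,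
    mul_sub, mul_comm (V.card : ℝ⟦X⟧), Finset.mul_sum]
  congr 1
  refine Finset.sum_congr rfl fun y _ => ?_
  rw [closedSeries, mul_left_comm, mul_inv_cyclePartition, mul_one]

theorem X_mul_derivative_closedSeries (lam : ℝ) (hx : x ∈ V) :
    X * d⁄dX ℝ (closedSeries R lam V x) =
      (hittingSeries R lam V x - 1) * closedSeries R lam V x := by
  have hcard : (V.card : ℝ⟦X⟧) = (V.erase x).card + 1 := by
    rw [← Finset.card_erase_add_one hx, Nat.cast_add, Nat.cast_one]
  have h1 := X_mul_derivative_eq_mul_closedSeries (R := R) lam V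
  have h2 := X_mul_derivative_eq_mul_closedSeries (R := R) lam (V.erase x)
  have h3 := mul_inv_cyclePartition (R := R) lam V
  rw [hcard] at h1
  rw [hittingSeries, closedSeries, Derivation.leibniz, derivative_inv']
  simp only [smul_eq_mul]
  unfold closedSeries at h1 h2 ⊢
  generalize cyclePartition R lam V = N at *
  generalize (∑ y ∈ V, cyclePartition R lam (V.erase y) * N⁻¹) = T at *
  generalize (∑ y ∈ V.erase x, cyclePartition R lam ((V.erase x).erase y) *
    (cyclePartition R lam (V.erase x))⁻¹) = T' at *
  generalize cyclePartition R lam (V.erase x) = N' at *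
  generalize ((V.erase x).card : ℝ⟦X⟧) = c at *
  linear_combination N⁻¹ * h2 - N' * N⁻¹ ^ 2 * h1 - N' * N⁻¹ * (c + 1 - T) * h3

theorem coeff_X_mul_derivative (P : ℝ⟦X⟧) (n : ℕ) :
    coeff n (X * d⁄dX ℝ P) = n * coeff n P := by
  cases n with
  | zero => simp
  | succ n => rw [coeff_succ_X_mul, coeff_derivative, mul_comm]; push_cast; rfl

theorem mul_closedWeight_finite (hx : x ∈ V) (n : ℕ) :
    n * closedWeight R lam V x n = ∑ p ∈ Finset.HasAntidiagonal.antidiagonal n,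
      (if p.1 = 0 then 0 else hittingWeight R lam V x p.1) * closedWeight R lam V x p.2 := by
  have h0 : coeff 0 (hittingSeries R lam V x - 1) = 0 := by
    have h := congrArg (coeff 0) (X_mul_derivative_closedSeries (R := R) lam hx)
    have hinv : constantCoeff (cyclePartition R lam V)⁻¹ = 1 := by
      have := congrArg constantCoeff (mul_inv_cyclePartition (R := R) lam V)
      rwa [map_mul, constantCoeff_cyclePartition, one_mul, map_one] at this
    simp only [coeff_zero_eq_constantCoeff_apply, map_mul, constantCoeff_X, zero_mul,
      closedSeries, constantCoeff_cyclePartition, hinv, mul_one] at h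
    rw [coeff_zero_eq_constantCoeff_apply, ← h]
  have hcoeff : ∀ k, 0 ≤ coeff k (hittingSeries R lam V x - 1) ∧
      (if k = 0 then 0 else hittingWeight R lam V x k) =
        ENNReal.ofReal (coeff k (hittingSeries R lam V x - 1)) := by
    intro k
    split_ifs with hk
    · subst hk
      rw [h0]
      simp
    · have : coeff k (hittingSeries R lam V x - 1) = coeff k (hittingSeries R lam V x) := by
        rw [map_sub, coeff_one, if_neg hk, sub_zero]
      rw [this]
      exact hittingWeight_eq k
  have key := congrArg (coeff n) (X_mul_derivative_closedSeries (R := R) lam hx)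
  rw [coeff_X_mul_derivative, coeff_mul] at key
  rw [(closedWeight_eq hx n).2, ← ENNReal.ofReal_natCast, ← ENNReal.ofReal_mul (Nat.cast_nonneg n),
    key, ENNReal.ofReal_sum_of_nonneg fun p _ =>
      mul_nonneg (hcoeff p.1).1 (closedWeight_eq hx p.2).1]
  refine Finset.sum_congr rfl fun p _ => ?_
  rw [ENNReal.ofReal_mul (hcoeff p.1).1, (hcoeff p.1).2, (closedWeight_eq hx p.2).2]

/-- The convolution identity between the weights of closed walks at `x` and of closed walks
through `x`, when walks of bounded length through `x` stay in a finite set. -/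
theorem mul_closedWeight (n : ℕ)
    (hV : ∀ w : List α, w.IsChain R → x ∈ w → w.length ≤ n + 1 → ∀ z ∈ w, z ∈ V) :
    n * closedWeight R lam Set.univ x n = ∑ p ∈ Finset.HasAntidiagonal.antidiagonal n,
      (if p.1 = 0 then 0 else hittingWeight R lam Set.univ x p.1) *
        closedWeight R lam Set.univ x p.2 := by
  have hx : x ∈ V := hV [x] (by simp) (by simp) (by simp) x (by simp)
  have h1 : ∀ k ≤ n, closedWeight R lam Set.univ x k = closedWeight R lam V x k := by
    intro k hk
    refine tsum_congr fun w => ?_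
    congr 1
    apply propext
    constructor
    · rintro ⟨h1, h2, h3, h4, h5⟩
      exact ⟨h1, h2, h3, hV w h1 (List.mem_of_getLast? h2) (by omega), h5⟩
    · rintro ⟨h1, h2, h3, h4, h5⟩
      exact ⟨h1, h2, h3, fun _ _ => Set.mem_univ _, h5⟩
  have h2 : ∀ k ≤ n, hittingWeight R lam Set.univ x k = hittingWeight R lam V x k := by
    intro k hk
    refine tsum_congr fun w => ?_
    congr 1
    apply propext
    constructor
    · rintro ⟨h1, h2, h3, h4, h5⟩
      exact ⟨h1, h2, h3, hV w h1 h5 (by omega), h5⟩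
    · rintro ⟨h1, h2, h3, h4, h5⟩
      exact ⟨h1, h2, h3, fun _ _ => Set.mem_univ _, h5⟩
  rw [h1 n le_rfl, mul_closedWeight_finite hx]
  refine Finset.sum_congr rfl fun p hp => ?_
  have := Finset.HasAntidiagonal.mem_antidiagonal.1 hp
  rw [h1 p.2 (by omega), h2 p.1 (by omega)]

end ClosedWalks

section Exponential

open PowerSeries

/-- The value at `z` of a power series with coefficients in `[0,∞]`. -/
def evalSeries (z : ℝ≥0∞) (P : ℝ≥0∞⟦X⟧) : ℝ≥0∞ := ∑' n, coeff n P * z ^ n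

theorem evalSeries_one (z : ℝ≥0∞) : evalSeries z 1 = 1 := by
  rw [evalSeries, tsum_eq_single 0]
  · simp
  · intro n hn
    simp [coeff_one, hn]

theorem evalSeries_mul (z : ℝ≥0∞) (P Q : ℝ≥0∞⟦X⟧) :
    evalSeries z (P * Q) = evalSeries z P * evalSeries z Q := by
  unfold evalSeries
  rw [← ENNReal.tsum_mul_right]
  simp only [← ENNReal.tsum_mul_left]
  rw [← ENNReal.tsum_prod, ← Finset.HasAntidiagonal.sigmaAntidiagonalEquivProd.tsum_eq, ENNReal.tsum_sigma']
  refine tsum_congr fun n => ?_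
  rw [tsum_fintype, coeff_mul, Finset.sum_mul,
    ← Finset.sum_coe_sort (Finset.HasAntidiagonal.antidiagonal n)]
  refine Finset.sum_congr rfl fun p _ => ?_
  have := Finset.HasAntidiagonal.mem_antidiagonal.1 p.2
  simp only [Finset.HasAntidiagonal.sigmaAntidiagonalEquivProd_apply]
  have hz : z ^ n = z ^ p.1.1 * z ^ p.1.2 := by rw [← pow_add, this]
  rw [hz]
  ring

theorem evalSeries_pow (z : ℝ≥0∞) (P : ℝ≥0∞⟦X⟧) (k : ℕ) :
    evalSeries z (P ^ k) = evalSeries z P ^ k := by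
  induction k with
  | zero => simp [evalSeries_one]
  | succ k ih => rw [pow_succ, evalSeries_mul, ih, pow_succ]

theorem eexp_eq_tsum (x : ℝ≥0∞) : eexp x = ∑' k : ℕ, x ^ k / (k.factorial : ℝ≥0∞) := by
  rw [eexp]
  split_ifs with h
  · subst h
    refine (top_le_iff.1 ?_).symm
    calc (⊤ : ℝ≥0∞) = ⊤ ^ 1 / ((Nat.factorial 1 : ℕ) : ℝ≥0∞) := by simp
      _ ≤ _ := ENNReal.le_tsum 1
  · rw [Real.exp_eq_exp_ℝ, NormedSpace.exp_eq_tsum_div]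
    dsimp only
    rw [ENNReal.ofReal_tsum_of_nonneg (fun k => by positivity)
      (Real.summable_pow_div_factorial _)]
    refine tsum_congr fun k => ?_
    rw [ENNReal.ofReal_div_of_pos (by positivity), ENNReal.ofReal_pow ENNReal.toReal_nonneg,
      ENNReal.ofReal_toReal h, ENNReal.ofReal_natCast]

theorem natCast_mul_coeff_pow_succ (B : ℝ≥0∞⟦X⟧) (n k : ℕ) :
    (n : ℝ≥0∞) * coeff n (B ^ (k + 1)) =
      (k + 1 : ℕ) * ∑ p ∈ Finset.HasAntidiagonal.antidiagonal n, (p.1 * coeff p.1 B) * coeff p.2 (B ^ k) := by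
  have hX : ∀ (P : ℝ≥0∞⟦X⟧) (m : ℕ), coeff m (X * d⁄dX ℝ≥0∞ P) = m * coeff m P := by
    intro P m
    cases m with
    | zero => simp
    | succ m => rw [coeff_succ_X_mul, coeff_derivative, mul_comm]; push_cast; rfl
  rw [← hX, derivative_pow, Nat.add_sub_cancel]
  have : X * (((k + 1 : ℕ) : ℝ≥0∞⟦X⟧) * B ^ k * d⁄dX ℝ≥0∞ B) =
      C ((k + 1 : ℕ) : ℝ≥0∞) * ((X * d⁄dX ℝ≥0∞ B) * B ^ k) := by
    rw [map_natCast]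
    ring
  rw [this, coeff_C_mul, coeff_mul]
  simp only [hX]

theorem tsum_eq_eexp {a b : ℕ → ℝ≥0∞} (z : ℝ≥0∞) (ha : a 0 = 1) (hb : b 0 = 0)
    (h : ∀ n : ℕ, n * a n = ∑ p ∈ Finset.HasAntidiagonal.antidiagonal n, (p.1 * b p.1) * a p.2) :
    ∑' n, a n * z ^ n = eexp (∑' n, b n * z ^ n) := by
  set B : ℝ≥0∞⟦X⟧ := PowerSeries.mk b with hB
  have hBc : ∀ n, coeff n B = b n := fun n => coeff_mk n b
  set e : ℕ → ℝ≥0∞ := fun n => ∑' k : ℕ, coeff n (B ^ k) / (k.factorial : ℝ≥0∞) with he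
  have he0 : e 0 = 1 := by
    rw [he]
    dsimp only
    rw [tsum_eq_single 0]
    · simp
    · intro k hk
      have : constantCoeff B = 0 := by rw [← coeff_zero_eq_constantCoeff_apply, hBc, hb]
      simp [this, hk]
  have hrec : ∀ n : ℕ, n * e n = ∑ p ∈ Finset.HasAntidiagonal.antidiagonal n, (p.1 * b p.1) * e p.2 := by
    intro n
    simp only [he, ← ENNReal.tsum_mul_left]
    rw [← Summable.tsum_finsetSum (fun _ _ => ENNReal.summable),
      tsum_eq_zero_add' ENNReal.summable]
    have h0 : (n : ℝ≥0∞) * (coeff n (B ^ 0) / ((Nat.factorial 0 : ℕ) : ℝ≥0∞)) = 0 := by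
      rw [pow_zero, coeff_one]
      split_ifs with hn <;> simp [hn]
    rw [h0, zero_add]
    refine tsum_congr fun k => ?_
    rw [← mul_div_assoc, natCast_mul_coeff_pow_succ, Nat.factorial_succ, Nat.cast_mul,
      ENNReal.mul_div_mul_left _ _ (by simp) (ENNReal.natCast_ne_top _),
      ENNReal.div_eq_inv_mul, Finset.mul_sum]
    refine Finset.sum_congr rfl fun p _ => ?_
    rw [hBc, ENNReal.div_eq_inv_mul]
    ring
  have hae : ∀ n, a n = e n := by
    intro n
    induction n using Nat.strong_induction_on with
    | _ n ih =>
      rcases Nat.eq_zero_or_pos n with rfl | hn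
      · rw [ha, he0]
      · have hn0 : (n : ℝ≥0∞) ≠ 0 := by exact_mod_cast hn.ne'
        rw [← ENNReal.mul_right_inj hn0 (ENNReal.natCast_ne_top n), h, hrec]
        refine Finset.sum_congr rfl fun p hp => ?_
        have := Finset.HasAntidiagonal.mem_antidiagonal.1 hp
        rcases Nat.eq_zero_or_pos p.1 with h0 | h0
        · simp [h0]
        · rw [ih p.2 (by omega)]
  have hev : ∑' n, b n * z ^ n = evalSeries z B := by simp only [evalSeries, hBc]
  rw [hev, eexp_eq_tsum]
  simp only [← evalSeries_pow]
  unfold evalSeries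
  simp only [hae, he, ENNReal.div_eq_inv_mul, ← ENNReal.tsum_mul_left, ← ENNReal.tsum_mul_right]
  rw [ENNReal.tsum_comm]
  simp only [mul_assoc]

end Exponential

section Lattice

variable {d : ℕ}

theorem adj_comm {x y : Pt d} : Adj x y ↔ Adj y x := by
  simp only [Adj, dist1, ← Int.natAbs_neg (x _ - y _), neg_sub]

theorem Adj.natAbs_sub_le {x y : Pt d} (h : Adj x y) (i : Fin d) : (x i - y i).natAbs ≤ 1 :=
  (Finset.single_le_sum (f := fun i => (x i - y i).natAbs) (fun _ _ => Nat.zero_le _)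
    (Finset.mem_univ i)).trans h.le

theorem natAbs_sub_lt_length {w : List (Pt d)} (hw : w.IsChain Adj) (i : Fin d) :
    ∀ x ∈ w, ∀ y ∈ w, (x i - y i).natAbs < w.length := by
  induction w with
  | nil => simp
  | cons a w ih =>
    have ih := ih hw.of_cons
    have hcons : ∀ y ∈ w, (a i - y i).natAbs < w.length + 1 := by
      intro y hy
      cases w with
      | nil => simp at hy
      | cons b t =>
        have h1 := (List.isChain_cons_cons.1 hw).1.natAbs_sub_le i
        have h2 := ih b (by simp) y hy
        omega
    intro x hx y hy
    rw [List.length_cons]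
    rcases List.mem_cons.1 hx with rfl | hx'
    · rcases List.mem_cons.1 hy with rfl | hy'
      · simp
      · exact hcons y hy'
    · rcases List.mem_cons.1 hy with rfl | hy'
      · have := hcons x hx'
        omega
      · have := ih x hx' y hy'
        omega

theorem isChain_reverse_adj {w : List (Pt d)} : w.reverse.IsChain Adj ↔ w.IsChain Adj := by
  have : (fun x y : Pt d => Adj y x) = Adj := by
    funext x y
    exact propext adj_comm
  rw [List.isChain_reverse, this]

theorem tsum_walk (f : List (Pt d) → ℝ≥0∞) :
    ∑' ω : Walk d, f ω.pts.reverse =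
      ∑' w : List (Pt d), if w ≠ [] ∧ w.IsChain Adj then f w else 0 := by
  have hinj : Function.Injective fun ω : Walk d => ω.pts.reverse := by
    rintro ⟨p, hp, hp'⟩ ⟨q, hq, hq'⟩ h
    have := List.reverse_injective h
    subst this
    rfl
  rw [← hinj.tsum_eq]
  · refine tsum_congr fun ω => (if_pos ⟨?_, ?_⟩).symm
    · simpa using ω.ne
    · exact isChain_reverse_adj.2 ω.chain
  · intro w hw
    rw [Function.mem_support] at hw
    by_cases h : w ≠ [] ∧ w.IsChain Adj
    · exact ⟨⟨w.reverse, by simpa using h.1, isChain_reverse_adj.2 h.2⟩, List.reverse_reverse w⟩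
    · exact absurd (if_neg h) hw

/-- The weight of a walk, in terms of its reversed list of vertices. -/
def listWeight (lam z : ℝ≥0) (w : List (Pt d)) : ℝ≥0∞ :=
  (z : ℝ≥0∞) ^ (w.length - 1) * (lam : ℝ≥0∞) ^ loopCount w

theorem wt_const (lam z : ℝ≥0) (ω : Walk d) :
    wt (fun _ => lam) z ω = listWeight lam z ω.pts.reverse := by
  rw [wt, wt0, listWeight, Multiset.map_const', Multiset.prod_replicate, card_erasedLoops,
    List.length_reverse, Walk.len]

theorem Walk.len_eq (ω : Walk d) : ω.len = ω.pts.reverse.length - 1 := by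
  rw [List.length_reverse, Walk.len]

theorem Walk.start_eq_iff (ω : Walk d) (x : Pt d) :
    ω.start = x ↔ ω.pts.reverse.getLast? = some x := by
  obtain ⟨p, hp, _⟩ := ω
  cases p with
  | nil => exact absurd rfl hp
  | cons a p => simp [Walk.start]

theorem Walk.finish_eq_iff (ω : Walk d) (x : Pt d) :
    ω.finish = x ↔ ω.pts.reverse.head? = some x := by
  obtain ⟨p, hp, _⟩ := ω
  rw [Walk.finish, List.head?_reverse, List.getLastD_eq_getLast?,
    List.getLast?_eq_some_getLast hp]
  simp

theorem Walk.isLoop_iff (ω : Walk d) :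
    ω.IsLoop ↔ 1 ≤ ω.pts.reverse.length - 1 ∧ ω.pts.reverse.head? = ω.pts.reverse.getLast? := by
  rw [Walk.IsLoop, Walk.len_eq, Walk.finish_eq_iff, ← (ω.start_eq_iff ω.start).1 rfl]

theorem tsum_closed_eq (lam z : ℝ≥0) :
    (∑' ω : Walk d, if ω.start = 0 ∧ ω.finish = 0 ∧ 1 ≤ ω.len
      then wt (fun _ : List (Pt d) => lam) z ω else 0) =
    ∑' w : List (Pt d), if w ≠ [] ∧ w.IsChain Adj then
      if w.getLast? = some 0 ∧ w.head? = some 0 ∧ 1 ≤ w.length - 1 then listWeight lam z w else 0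
      else 0 := by
  rw [← tsum_walk]
  simp only [wt_const, Walk.len_eq, Walk.start_eq_iff, Walk.finish_eq_iff]

theorem G_eq (lam z : ℝ≥0) (x y : Pt d) :
    G (fun _ : List (Pt d) => lam) z x y =
    ∑' w : List (Pt d), if w ≠ [] ∧ w.IsChain Adj then
      if w.getLast? = some x ∧ w.head? = some y then listWeight lam z w else 0 else 0 := by
  rw [← tsum_walk]
  simp only [G, wt_const, Walk.start_eq_iff, Walk.finish_eq_iff]

theorem mu_singleton_eq (lam z : ℝ≥0) (x : Pt d) :
    mu (fun _ : List (Pt d) => lam) z {x} ∅ =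
    ∑' w : List (Pt d), if w ≠ [] ∧ w.IsChain Adj then
      if (1 ≤ w.length - 1 ∧ w.head? = w.getLast?) ∧ x ∈ w
        then listWeight lam z w / ((w.length - 1 : ℕ) : ℝ≥0∞) else 0 else 0 := by
  rw [← tsum_walk]
  simp only [mu, wt_const, Walk.isLoop_iff, Walk.len_eq, Walk.range, Set.inter_singleton_nonempty,
    Set.mem_ofPred_eq, Set.inter_empty, and_true, List.mem_reverse]

theorem listWeight_zero_cons (lam z : ℝ≥0) {w : List (Pt d)} {x : Pt d}
    (hw : w.getLast? = some x) :
    listWeight lam z (x :: w) = z * lam * listWeight lam z w := by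
  have hx : x ∈ stack w := List.mem_of_getLast? (by rw [stack_getLast?, hw])
  have hlen : w.length = w.length - 1 + 1 := by
    cases w with
    | nil => simp at hw
    | cons => simp
  rw [listWeight, listWeight, loopCount, if_pos hx, List.length_cons, Nat.add_sub_cancel, pow_succ]
  nth_rw 1 [hlen]
  rw [pow_succ]
  ring

theorem tsum_closed_eq_mul_tsum_G (lam z : ℝ≥0) :
    (∑' ω : Walk d, if ω.start = 0 ∧ ω.finish = 0 ∧ 1 ≤ ω.len
      then wt (fun _ : List (Pt d) => lam) z ω else 0) =
    (z : ℝ≥0∞) * (lam : ℝ≥0∞) *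
      ∑' u : Pt d, (if Adj u 0 then G (fun _ : List (Pt d) => lam) z 0 u else 0) := by
  have hG : ∀ u : Pt d, (if Adj u 0 then G (fun _ : List (Pt d) => lam) z 0 u else 0) =
      ∑' w : List (Pt d), if Adj u 0 then if w ≠ [] ∧ w.IsChain Adj then
        if w.getLast? = some 0 ∧ w.head? = some u then listWeight lam z w else 0 else 0 else 0 := by
    intro u
    split_ifs
    · exact G_eq lam z 0 u
    · simp
  rw [tsum_closed_eq, tsum_congr hG, ENNReal.tsum_comm, ← ENNReal.tsum_mul_left,
    ← (List.cons_injective (a := (0 : Pt d))).tsum_eq]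
  · refine tsum_congr fun w => ?_
    cases w with
    | nil => simp
    | cons u w =>
      rw [tsum_eq_single u]
      · simp only [ne_eq, reduceCtorEq, not_false_eq_true, true_and, List.isChain_cons_cons,
          List.getLast?_cons_cons, List.head?_cons, and_true, List.length_cons,
          Nat.add_sub_cancel, adj_comm (x := 0) (y := u)]
        by_cases h1 : Adj u 0 <;> by_cases h2 : (u :: w).IsChain Adj <;>
          by_cases h3 : (u :: w).getLast? = some 0 <;> simp [h1, h2, h3, listWeight_zero_cons]
      · intro v hv
        simp [hv.symm]
  · intro w hw
    rw [Function.mem_support] at hw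
    split_ifs at hw with h1 h2
    · cases w with
      | nil => simp at h1
      | cons a w => exact ⟨w, by simpa using h2.2.1.symm⟩
    all_goals exact absurd rfl hw

theorem tsum_length_fiber {α : Type*} (P : List α → Prop) [DecidablePred P]
    (g : List α → ℝ≥0∞) (c : ℕ → ℝ≥0∞) :
    ∑' n, (∑' w : List α, if P w ∧ w.length = n + 1 then g w else 0) * c n =
      ∑' w : List α, if P w ∧ w ≠ [] then g w * c (w.length - 1) else 0 := by
  simp only [← ENNReal.tsum_mul_right]
  rw [ENNReal.tsum_comm]
  refine tsum_congr fun w => ?_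
  cases w with
  | nil => simp
  | cons a w =>
    rw [tsum_eq_single w.length]
    · simp [ite_mul]
    · intro n hn
      rw [if_neg, zero_mul]
      rintro ⟨-, h⟩
      exact hn (by simpa using h.symm)

theorem tsum_closedWeight (lam z : ℝ≥0) :
    ∑' n, closedWeight Adj lam Set.univ (0 : Pt d) n * (z : ℝ≥0∞) ^ n =
    1 + ∑' ω : Walk d, if ω.start = 0 ∧ ω.finish = 0 ∧ 1 ≤ ω.len
      then wt (fun _ : List (Pt d) => lam) z ω else 0 := by
  have h := tsum_length_fiber
    (fun w : List (Pt d) => w.IsChain Adj ∧ w.getLast? = some 0 ∧ w.head? = some 0)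
    (fun w => (lam : ℝ≥0∞) ^ loopCount w) (fun n => (z : ℝ≥0∞) ^ n)
  have hc : ∀ n, closedWeight Adj lam Set.univ (0 : Pt d) n =
      ∑' w : List (Pt d), if (w.IsChain Adj ∧ w.getLast? = some 0 ∧ w.head? = some 0) ∧
        w.length = n + 1 then (lam : ℝ≥0∞) ^ loopCount w else 0 := by
    intro n
    refine tsum_congr fun w => ?_
    congr 1
    apply propext
    simp only [Set.mem_univ, implies_true, true_and]
    tauto
  simp only [hc]
  rw [h, tsum_closed_eq, ← tsum_ite_eq ([0] : List (Pt d)) (fun _ => (1 : ℝ≥0∞)),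
    ← ENNReal.tsum_add]
  refine tsum_congr fun w => ?_
  match w with
  | [] => simp
  | [a] =>
    by_cases ha : a = 0
    · simp [ha, loopCount, stack]
    · simp [ha]
  | a :: b :: w =>
    simp only [listWeight, mul_comm ((lam : ℝ≥0∞) ^ _)]
    by_cases h1 : (a :: b :: w).IsChain Adj <;>
      by_cases h2 : (a :: b :: w).getLast? = some 0 <;>
      by_cases h3 : (a :: b :: w).head? = some 0 <;> simp [h1, h2, h3]

theorem tsum_hittingWeight (lam z : ℝ≥0) (x : Pt d) :
    ∑' n : ℕ, (if n = 0 then 0 else hittingWeight Adj lam Set.univ x n / (n : ℝ≥0∞)) *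
      (z : ℝ≥0∞) ^ n = mu (fun _ : List (Pt d) => lam) z {x} ∅ := by
  have h := tsum_length_fiber
    (fun w : List (Pt d) => w.IsChain Adj ∧ w.head? = w.getLast? ∧ x ∈ w)
    (fun w => (lam : ℝ≥0∞) ^ loopCount w)
    (fun n => if n = 0 then 0 else (n : ℝ≥0∞)⁻¹ * (z : ℝ≥0∞) ^ n)
  have hc : ∀ n, hittingWeight Adj lam Set.univ x n =
      ∑' w : List (Pt d), if (w.IsChain Adj ∧ w.head? = w.getLast? ∧ x ∈ w) ∧
        w.length = n + 1 then (lam : ℝ≥0∞) ^ loopCount w else 0 := by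
    intro n
    refine tsum_congr fun w => ?_
    congr 1
    apply propext
    simp only [Set.mem_univ, implies_true, true_and]
    tauto
  have hb : ∀ n : ℕ, (if n = 0 then 0 else hittingWeight Adj lam Set.univ x n / (n : ℝ≥0∞)) *
      (z : ℝ≥0∞) ^ n = (∑' w : List (Pt d), if (w.IsChain Adj ∧ w.head? = w.getLast? ∧ x ∈ w) ∧
        w.length = n + 1 then (lam : ℝ≥0∞) ^ loopCount w else 0) *
        if n = 0 then 0 else (n : ℝ≥0∞)⁻¹ * (z : ℝ≥0∞) ^ n := by
    intro n
    rw [← hc]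
    split_ifs
    · simp
    · rw [div_eq_mul_inv, mul_assoc]
  rw [tsum_congr hb, h, mu_singleton_eq]
  refine tsum_congr fun w => ?_
  by_cases h0 : w.length - 1 = 0
  · simp [h0]
  · have h1 : 1 ≤ w.length - 1 := Nat.one_le_iff_ne_zero.2 h0
    rw [if_neg h0, ← ite_and]
    congr 1
    · apply propext
      tauto
    · rw [listWeight, div_eq_mul_inv]
      ring

theorem eexp_mu_singleton (lam z : ℝ≥0) :
    eexp (mu (fun _ : List (Pt d) => lam) z {(0 : Pt d)} ∅) =
    1 + ∑' ω : Walk d, if ω.start = 0 ∧ ω.finish = 0 ∧ 1 ≤ ω.len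
      then wt (fun _ : List (Pt d) => lam) z ω else 0 := by
  rw [← tsum_closedWeight, ← tsum_hittingWeight]
  refine (tsum_eq_eexp _ ?_ (if_pos rfl) fun n => ?_).symm
  · rw [closedWeight, tsum_eq_single [0]]
    · simp [loopCount, stack]
    · intro w hw
      refine if_neg ?_
      rintro ⟨-, -, h3, -, h5⟩
      obtain ⟨a, rfl⟩ := List.length_eq_one_iff.1 h3
      exact hw (by simpa using h5)
  · rw [mul_closedWeight (V := Finset.Icc (fun _ => -(n : ℤ)) (fun _ => (n : ℤ))) n]
    · refine Finset.sum_congr rfl fun p _ => ?_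
      split_ifs with h
      · simp
      · rw [ENNReal.mul_div_cancel (by exact_mod_cast h) (ENNReal.natCast_ne_top _)]
    · intro w hw h0 hlen y hy
      have := fun i => natAbs_sub_lt_length hw i y hy 0 h0
      simp only [Pi.zero_apply, sub_zero] at this
      rw [Finset.mem_Icc]
      constructor <;> intro i <;> have := this i <;> dsimp only <;> omega

end Lattice

/-- **Last-step decomposition of closed walks.**  For constants `λ ≥ 0` and `z ≥ 0`,
the total λ-LWW weight of closed walks at the origin with at least one step equals
`z·λ·Σ_{‖u‖₁=1} G_{λ,z}(0,u)`; equivalently, `exp(μ_{λ,z}({0})) − 1` equals the same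
quantity.  (Identities in `[0,∞]`.) -/
theorem last_step_decomposition {d : ℕ} (lam z : ℝ≥0) :
    (∑' ω : Walk d,
        if ω.start = 0 ∧ ω.finish = 0 ∧ 1 ≤ ω.len
        then wt (fun _ : List (Pt d) => lam) z ω else 0)
      = (z : ℝ≥0∞) * (lam : ℝ≥0∞)
          * ∑' u : Pt d, (if Adj u 0 then G (fun _ : List (Pt d) => lam) z 0 u else 0)
    ∧ eexp (mu (fun _ : List (Pt d) => lam) z {(0 : Pt d)} ∅) - 1
      = (z : ℝ≥0∞) * (lam : ℝ≥0∞)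
          * ∑' u : Pt d, (if Adj u 0 then G (fun _ : List (Pt d) => lam) z 0 u else 0) := by
  refine ⟨tsum_closed_eq_mul_tsum_G lam z, ?_⟩
  rw [eexp_mu_singleton, ENNReal.add_sub_cancel_left ENNReal.one_ne_top,
    tsum_closed_eq_mul_tsum_G]

end LWW
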